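/- Let H ∈ (3/4, 1) and define R_H(s,t) = ½( s^{2H} + t^{2H} − |t−s|^{2H} ) for s, t ≥ 0. For integers d, d' ≥ 1 and 0 ≤ p ≤ d−1, 0 ≤ q ≤ d'−1, set D_{d,d'}(p,q) = R_H((p+1)/d, (q+1)/d') − R_H((p+1)/d, q/d') − R_H(p/d, (q+1)/d') + R_H(p/d, q/d'). Then, as d and d' both tend to infinity, d·d' · Σ_{p=0}^{d−1} Σ_{q=0}^{d'−1} D_{d,d'}(p,q)² → H²(2H−1)² ∫_0^1 ∫_0^1 |u−v|^{4H−4} du dv. -/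

import Mathlib

open MeasureTheory Set Filter Topology

theorem intervalIntegrable_abs_rpow {r : ℝ} (hr : -1 < r) (a b : ℝ) :
    IntervalIntegrable (fun x : ℝ => |x| ^ r) volume a b := by
  have h_nonneg : ∀ t : ℝ, 0 ≤ t → IntervalIntegrable (fun x : ℝ => |x| ^ r) volume 0 t := by
    intro t ht
    refine (intervalIntegral.intervalIntegrable_rpow' hr (a := 0) (b := t)).congr fun x hx => ?_
    rw [uIoc_of_le ht] at hx
    simp only [abs_of_pos hx.1]
  have h_all : ∀ t : ℝ, IntervalIntegrable (fun x : ℝ => |x| ^ r) volume 0 t := by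
    intro t
    rcases le_total 0 t with ht | ht
    · exact h_nonneg t ht
    · have h := (IntervalIntegrable.iff_comp_neg (by simp)).mp (h_nonneg (-t) (by linarith))
      simpa using h
  exact (h_all a).symm.trans (h_all b)

theorem integrableOn_abs_sub_rpow {r : ℝ} (hr : -1 < r) :
    IntegrableOn (fun z : ℝ × ℝ => |z.1 - z.2| ^ r) (Ioc 0 1 ×ˢ Ioc 0 1) := by
  have h_strip : IntegrableOn (fun z : ℝ × ℝ => |z.1| ^ r) (Ioc (-1) 1 ×ˢ Ioc 0 1) := by
    have h := (intervalIntegrable_iff_integrableOn_Ioc_of_le (by norm_num)).mp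
      (intervalIntegrable_abs_rpow hr (-1) 1)
    have h' := Integrable.comp_fst h (volume.restrict (Ioc (0 : ℝ) 1))
    rwa [Measure.prod_restrict] at h'
  have h_shear : MeasurePreserving (fun z : ℝ × ℝ => (z.1 - z.2, z.2)) volume volume :=
    measurePreserving_sub_prod volume volume
  rw [← integrable_indicator_iff (by measurability)] at h_strip
  have h_comp := h_shear.integrable_comp_of_integrable h_strip
  refine (h_comp.integrableOn (s := Ioc 0 1 ×ˢ Ioc 0 1)).congr_fun ?_ (by measurability)
  rintro ⟨x, y⟩ ⟨hx, hy⟩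
  simp only [mem_Ioc] at hx hy
  have h_mem : (x - y, y) ∈ Ioc (-1 : ℝ) 1 ×ˢ Ioc (0 : ℝ) 1 :=
    ⟨⟨by simp only; linarith, by simp only; linarith⟩, hy⟩
  simp [Function.comp, indicator_of_mem h_mem]

theorem ae_fst_ne_snd : ∀ᵐ z : ℝ × ℝ, z.1 ≠ z.2 := by
  have h : Measure.QuasiMeasurePreserving (fun z : ℝ × ℝ => z.1 - z.2) volume volume :=
    quasiMeasurePreserving_sub volume volume
  filter_upwards [h.ae (Measure.ae_ne volume (0 : ℝ))] with z hz
  exact sub_ne_zero.mp hz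

theorem continuous_deriv_abs_rpow {p : ℝ} (hp : 1 < p) :
    Continuous fun x : ℝ => p * |x| ^ (p - 2) * x := by
  have h := (contDiff_norm_rpow (E := ℝ) hp).continuous_deriv le_rfl
  convert h using 1
  ext x
  exact (hasDerivAt_abs_rpow x hp).deriv.symm

theorem integral_abs_rpow_sub_two {p : ℝ} (hp : 1 < p) (a b : ℝ) :
    p * (p - 1) * ∫ x in a..b, |x| ^ (p - 2) =
      p * |b| ^ (p - 2) * b - p * |a| ^ (p - 2) * a := by
  have h_cont := continuous_deriv_abs_rpow hp
  rw [← intervalIntegral.integral_const_mul]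
  refine integral_eq_of_hasDerivAt_off_countable (fun x : ℝ => p * |x| ^ (p - 2) * x) _
    (countable_singleton (0 : ℝ)) h_cont.continuousOn ?_
    ((intervalIntegrable_abs_rpow (by linarith) a b).const_mul _)
  rintro x ⟨-, hx⟩
  have hx0 : x ≠ 0 := hx
  have h := (((hasDerivAt_abs hx0).rpow_const (p := p - 2) (Or.inl (abs_ne_zero.mpr hx0))).const_mul
    p).mul (hasDerivAt_id x)
  refine h.congr_deriv ?_
  have h_pow : |x| ^ (p - 2) = |x| ^ (p - 2 - 1) * |x| := by
    rw [← Real.rpow_add_one (abs_ne_zero.mpr hx0)]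
    ring_nf
  have h_sign : (SignType.sign x : ℝ) * x = |x| := sign_mul_self x
  rw [id_eq]
  linear_combination p * |x| ^ (p - 2 - 1) * (p - 2) * h_sign - p * (p - 2) * h_pow

theorem integral_integral_abs_sub_rpow {p : ℝ} (hp : 1 < p) (a b c d : ℝ) :
    p * (p - 1) * ∫ u in a..b, ∫ v in c..d, |u - v| ^ (p - 2) =
      |b - c| ^ p - |a - c| ^ p - |b - d| ^ p + |a - d| ^ p := by
  have h_cont := continuous_deriv_abs_rpow hp
  have h_outer : ∀ t : ℝ, ∫ u in a..b, p * |u - t| ^ (p - 2) * (u - t) =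
      |b - t| ^ p - |a - t| ^ p := by
    intro t
    rw [intervalIntegral.integral_comp_sub_right (fun x : ℝ => p * |x| ^ (p - 2) * x) t]
    exact intervalIntegral.integral_eq_sub_of_hasDerivAt
      (fun x _ => hasDerivAt_abs_rpow x hp) (h_cont.intervalIntegrable _ _)
  have h_int : ∀ t : ℝ,
      IntervalIntegrable (fun u : ℝ => p * |u - t| ^ (p - 2) * (u - t)) volume a b := fun t =>
    (h_cont.comp (continuous_id.sub continuous_const)).intervalIntegrable _ _
  rw [← intervalIntegral.integral_const_mul]
  have h_inner : ∀ u : ℝ, p * (p - 1) * ∫ v in c..d, |u - v| ^ (p - 2) =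
      p * |u - c| ^ (p - 2) * (u - c) - p * |u - d| ^ (p - 2) * (u - d) := by
    intro u
    rw [intervalIntegral.integral_comp_sub_left (fun x : ℝ => |x| ^ (p - 2)) u]
    exact integral_abs_rpow_sub_two hp _ _
  simp only [h_inner]
  rw [intervalIntegral.integral_sub (h_int c) (h_int d), h_outer, h_outer]
  ring

theorem sq_setIntegral_le {α : Type*} [MeasurableSpace α] {μ : Measure α} {A : Set α}
    {f : α → ℝ} (hA : μ A ≠ ⊤) (hf : IntegrableOn f A μ)
    (hf2 : IntegrableOn (fun z => f z ^ 2) A μ) :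
    (∫ z in A, f z ∂μ) ^ 2 ≤ μ.real A * ∫ z in A, f z ^ 2 ∂μ := by
  have h_const : ∀ c : ℝ, IntegrableOn (fun _ => c) A μ := fun c => integrableOn_const hA
  have h_quad : ∀ t : ℝ, 0 ≤ μ.real A * (t * t) + (-2 * ∫ z in A, f z ∂μ) * t
      + ∫ z in A, f z ^ 2 ∂μ := by
    intro t
    have h := integral_nonneg (μ := μ.restrict A) (f := fun z => f z ^ 2 - 2 * t * f z + t * t)
      fun z => by
        show 0 ≤ f z ^ 2 - 2 * t * f z + t * t
        nlinarith [sq_nonneg (f z - t)]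
    have h_add := integral_add (hf2.sub (hf.const_mul (2 * t))) (h_const (t * t))
    simp only [Pi.sub_apply] at h_add
    rw [h_add, integral_sub hf2 (hf.const_mul _), integral_const_mul, setIntegral_const,
      smul_eq_mul] at h
    linarith
  have h := discrim_le_zero h_quad
  rw [discrim] at h
  linarith

theorem setIntegral_unit_square_eq_sum {f : ℝ × ℝ → ℝ}
    (hf : IntegrableOn f (Ioc 0 1 ×ˢ Ioc 0 1)) {m n : ℕ} (hm : 0 < m) (hn : 0 < n) :
    ∫ z in Ioc (0 : ℝ) 1 ×ˢ Ioc (0 : ℝ) 1, f z =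
      ∑ p ∈ Finset.range m, ∑ q ∈ Finset.range n,
        ∫ z in Ioc ((p : ℝ) / m) (((p : ℝ) + 1) / m) ×ˢ Ioc ((q : ℝ) / n) (((q : ℝ) + 1) / n),
          f z := by
  have h_mono : ∀ k : ℕ, Monotone fun i : ℕ => (i : ℝ) / k := fun k i j hij => by
    simp only
    gcongr
  have h_union : ∀ k : ℕ, 0 < k →
      ⋃ i ∈ Finset.range k, Ioc ((i : ℝ) / k) (((i : ℝ) + 1) / k) = Ioc (0 : ℝ) 1 := by
    intro k hk
    have h := (h_mono k).biUnion_Ico_Ioc_map_succ 0 k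
    have hk' : (k : ℝ) ≠ 0 := by positivity
    simpa [div_self hk'] using h
  have h_disj : ∀ k : ℕ, Pairwise (Function.onFun Disjoint fun i : ℕ =>
      Ioc ((i : ℝ) / k) (((i : ℝ) + 1) / k)) := by
    intro k
    simpa using (h_mono k).pairwise_disjoint_on_Ioc_succ
  have h_sq : (⋃ i ∈ Finset.range m ×ˢ Finset.range n,
      Ioc ((i.1 : ℝ) / m) (((i.1 : ℝ) + 1) / m) ×ˢ Ioc ((i.2 : ℝ) / n) (((i.2 : ℝ) + 1) / n)) =
      Ioc (0 : ℝ) 1 ×ˢ Ioc (0 : ℝ) 1 := by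
    rw [← congrArg₂ (· ×ˢ ·) (h_union m hm) (h_union n hn)]
    ext ⟨x, y⟩
    simp only [mem_iUnion, mem_prod, Finset.mem_product, exists_prop, Prod.exists]
    grind
  rw [← Finset.sum_product', ← h_sq]
  refine integral_biUnion_finset _ (fun i _ => by measurability) ?_ fun i hi => ?_
  · rintro ⟨i, j⟩ - ⟨i', j'⟩ - hne
    simp only [Function.onFun, Set.disjoint_prod]
    by_cases h : i = i'
    · exact Or.inr (h_disj n fun h' => hne (by rw [h, h']))
    · exact Or.inl (h_disj m h)
  · refine hf.mono_set ?_
    rw [← h_sq]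
    exact subset_biUnion_of_mem (u := fun i : ℕ × ℕ => Ioc ((i.1 : ℝ) / m) (((i.1 : ℝ) + 1) / m) ×ˢ
      Ioc ((i.2 : ℝ) / n) (((i.2 : ℝ) + 1) / n)) hi

theorem integrableOn_abs_sub_add_rpow {r η : ℝ} (hr : -1 < r) (hr0 : r ≤ 0) (hη : 0 < η) :
    IntegrableOn (fun z : ℝ × ℝ => (|z.1 - z.2| + η) ^ r) (Ioc 0 1 ×ˢ Ioc 0 1) := by
  refine (integrableOn_abs_sub_rpow hr).mono'
    (Measurable.aestronglyMeasurable (by fun_prop)) ?_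
  filter_upwards [ae_restrict_of_ae ae_fst_ne_snd] with z hz
  rw [Real.norm_of_nonneg (by positivity)]
  exact Real.rpow_le_rpow_of_nonpos (abs_pos.mpr (sub_ne_zero.mpr hz)) (by linarith) hr0

theorem tendsto_setIntegral_abs_sub_add_rpow {r : ℝ} (hr : -1 < r) (hr0 : r ≤ 0) :
    Tendsto (fun η : ℝ => ∫ z in Ioc (0 : ℝ) 1 ×ˢ Ioc (0 : ℝ) 1, (|z.1 - z.2| + η) ^ r)
      (𝓝[>] 0) (𝓝 (∫ z in Ioc (0 : ℝ) 1 ×ˢ Ioc (0 : ℝ) 1, |z.1 - z.2| ^ r)) := by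
  refine tendsto_integral_filter_of_dominated_convergence _
    (Eventually.of_forall fun η => Measurable.aestronglyMeasurable (by fun_prop)) ?_ (integrableOn_abs_sub_rpow hr) ?_
  · filter_upwards [self_mem_nhdsWithin] with η hη
    have hη' : 0 < η := hη
    filter_upwards [ae_restrict_of_ae ae_fst_ne_snd] with z hz
    rw [Real.norm_of_nonneg (by positivity)]
    exact Real.rpow_le_rpow_of_nonpos (abs_pos.mpr (sub_ne_zero.mpr hz)) (by linarith) hr0
  · filter_upwards [ae_restrict_of_ae ae_fst_ne_snd] with z hz
    have h : ContinuousAt (fun η : ℝ => (|z.1 - z.2| + η) ^ r) 0 :=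
      (continuousAt_const.add continuousAt_id).rpow_const
        (Or.inl (by simpa using sub_ne_zero.mpr hz))
    simpa using h.tendsto.mono_left nhdsWithin_le_nhds

theorem volume_real_Ioc_prod_Ioc {a b c d : ℝ} (hab : a ≤ b) (hcd : c ≤ d) :
    volume.real (Ioc a b ×ˢ Ioc c d) = (b - a) * (d - c) := by
  rw [Measure.volume_eq_prod, measureReal_prod_prod, Real.volume_real_Ioc_of_le hab,
    Real.volume_real_Ioc_of_le hcd]

theorem volume_Ioc_prod_Ioc_ne_top (a b c d : ℝ) : volume (Ioc a b ×ˢ Ioc c d) ≠ ⊤ := by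
  rw [Measure.volume_eq_prod, Measure.prod_prod, Real.volume_Ioc, Real.volume_Ioc]
  exact ENNReal.mul_ne_top ENNReal.ofReal_ne_top ENNReal.ofReal_ne_top

theorem abs_rpow_sq (x r : ℝ) : (|x| ^ r) ^ 2 = |x| ^ (2 * r) := by
  rw [mul_comm 2 r, ← Real.rpow_mul_natCast (abs_nonneg x)]
  norm_cast

theorem volume_mul_setIntegral_le_sq {r a b c d : ℝ} (hr0 : r ≤ 0) (hab : a < b) (hcd : c < d)
    (hf : IntegrableOn (fun z : ℝ × ℝ => |z.1 - z.2| ^ r) (Ioc a b ×ˢ Ioc c d))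
    (hg : IntegrableOn (fun z : ℝ × ℝ => (|z.1 - z.2| + (b - a + (d - c))) ^ (2 * r))
      (Ioc a b ×ˢ Ioc c d)) :
    (b - a) * (d - c) *
      ∫ z in Ioc a b ×ˢ Ioc c d, (|z.1 - z.2| + (b - a + (d - c))) ^ (2 * r) ≤
      (∫ z in Ioc a b ×ˢ Ioc c d, |z.1 - z.2| ^ r) ^ 2 := by
  set A := Ioc a b ×ˢ Ioc c d with hA
  set V := (b - a) * (d - c) with hV
  have hVpos : 0 < V := mul_pos (by linarith) (by linarith)
  have h_vol : volume.real A = V := volume_real_Ioc_prod_Ioc hab.le hcd.le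
  have h_top : volume A ≠ ⊤ := volume_Ioc_prod_Ioc_ne_top a b c d
  have hA_meas : MeasurableSet A := measurableSet_Ioc.prod measurableSet_Ioc
  have h_point : ∀ w ∈ A, V * (|w.1 - w.2| + (b - a + (d - c))) ^ r ≤
      ∫ z in A, |z.1 - z.2| ^ r := by
    rintro ⟨u, v⟩ ⟨hu, hv⟩
    simp only [mem_Ioc] at hu hv
    rw [← h_vol, ← smul_eq_mul, ← setIntegral_const]
    refine setIntegral_mono_ae_restrict (integrableOn_const h_top) hf ?_
    filter_upwards [ae_restrict_of_ae ae_fst_ne_snd, ae_restrict_mem hA_meas] with z hz hzA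
    obtain ⟨hx, hy⟩ := hzA
    simp only [mem_Ioc] at hx hy
    refine Real.rpow_le_rpow_of_nonpos (abs_pos.mpr (sub_ne_zero.mpr hz)) ?_ hr0
    rw [abs_le]
    constructor
    · linarith [neg_abs_le (u - v)]
    · linarith [le_abs_self (u - v)]
  have h_sq : ∀ w ∈ A, V ^ 2 * (|w.1 - w.2| + (b - a + (d - c))) ^ (2 * r) ≤
      (∫ z in A, |z.1 - z.2| ^ r) ^ 2 := by
    intro w hw
    have h_nonneg : 0 ≤ |w.1 - w.2| + (b - a + (d - c)) := by
      have := abs_nonneg (w.1 - w.2)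
      linarith
    have h := pow_le_pow_left₀ (mul_nonneg hVpos.le (Real.rpow_nonneg h_nonneg r)) (h_point w hw) 2
    have h_eq := abs_rpow_sq (|w.1 - w.2| + (b - a + (d - c))) r
    rw [abs_of_nonneg h_nonneg] at h_eq
    rwa [mul_pow, h_eq] at h
  have h := setIntegral_mono_on (hg.const_mul (V ^ 2)) (integrableOn_const h_top) hA_meas h_sq
  rw [integral_const_mul, setIntegral_const, h_vol, smul_eq_mul, pow_two, mul_assoc] at h
  exact le_of_mul_le_mul_left h hVpos

theorem sum_cell_bounds {r : ℝ} (hr : -1 / 2 < r) (hr0 : r ≤ 0) {m n : ℕ} (hm : 0 < m)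
    (hn : 0 < n) :
    ∫ z in Ioc (0 : ℝ) 1 ×ˢ Ioc (0 : ℝ) 1,
        (|z.1 - z.2| + (1 / (m : ℝ) + 1 / (n : ℝ))) ^ (2 * r) ≤
      (m : ℝ) * n * ∑ p ∈ Finset.range m, ∑ q ∈ Finset.range n,
        (∫ z in Ioc ((p : ℝ) / m) (((p : ℝ) + 1) / m) ×ˢ Ioc ((q : ℝ) / n) (((q : ℝ) + 1) / n),
          |z.1 - z.2| ^ r) ^ 2 ∧
    (m : ℝ) * n * ∑ p ∈ Finset.range m, ∑ q ∈ Finset.range n,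
        (∫ z in Ioc ((p : ℝ) / m) (((p : ℝ) + 1) / m) ×ˢ Ioc ((q : ℝ) / n) (((q : ℝ) + 1) / n),
          |z.1 - z.2| ^ r) ^ 2 ≤
      ∫ z in Ioc (0 : ℝ) 1 ×ˢ Ioc (0 : ℝ) 1, |z.1 - z.2| ^ (2 * r) := by
  have hm' : (0 : ℝ) < m := by exact_mod_cast hm
  have hn' : (0 : ℝ) < n := by exact_mod_cast hn
  have h_int := integrableOn_abs_sub_rpow (r := r) (by linarith)
  have h_int2 := integrableOn_abs_sub_rpow (r := 2 * r) (by linarith)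
  have h_int3 := integrableOn_abs_sub_add_rpow (r := 2 * r) (η := 1 / (m : ℝ) + 1 / (n : ℝ))
    (by linarith) (by linarith) (by positivity)
  have h_sub : ∀ k : ℕ, 0 < (k : ℝ) → ∀ i ∈ Finset.range k,
      Ioc ((i : ℝ) / k) (((i : ℝ) + 1) / k) ⊆ Ioc (0 : ℝ) 1 := by
    intro k hk i hi
    have hi' : (i : ℝ) + 1 ≤ k := by exact_mod_cast Finset.mem_range.mp hi
    exact Ioc_subset_Ioc (by positivity) ((div_le_one hk).mpr hi')
  have h_len : ∀ k i : ℕ, ((i : ℝ) + 1) / k - (i : ℝ) / k = 1 / k := fun k i => by ring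
  rw [setIntegral_unit_square_eq_sum h_int3 hm hn, setIntegral_unit_square_eq_sum h_int2 hm hn]
  simp only [Finset.mul_sum]
  constructor
  · refine Finset.sum_le_sum fun p hp => Finset.sum_le_sum fun q hq => ?_
    have h_cell := prod_mono (h_sub m hm' p hp) (h_sub n hn' q hq)
    have h := volume_mul_setIntegral_le_sq (r := r) (a := (p : ℝ) / m) (b := ((p : ℝ) + 1) / m)
      (c := (q : ℝ) / n) (d := ((q : ℝ) + 1) / n) hr0 (by gcongr; linarith) (by gcongr; linarith)
      (h_int.mono_set h_cell) (by simpa only [h_len] using h_int3.mono_set h_cell)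
    simp only [h_len] at h
    calc _ = (m : ℝ) * n * (1 / m * (1 / n) * ∫ z in Ioc ((p : ℝ) / m) (((p : ℝ) + 1) / m) ×ˢ
          Ioc ((q : ℝ) / n) (((q : ℝ) + 1) / n),
            (|z.1 - z.2| + (1 / (m : ℝ) + 1 / (n : ℝ))) ^ (2 * r)) := by field_simp
      _ ≤ _ := mul_le_mul_of_nonneg_left h (by positivity)
  · refine Finset.sum_le_sum fun p hp => Finset.sum_le_sum fun q hq => ?_
    have h_cell := prod_mono (h_sub m hm' p hp) (h_sub n hn' q hq)
    have h := sq_setIntegral_le (volume_Ioc_prod_Ioc_ne_top _ _ _ _) (h_int.mono_set h_cell)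
      (by simpa only [abs_rpow_sq] using h_int2.mono_set h_cell)
    rw [volume_real_Ioc_prod_Ioc (by gcongr; linarith) (by gcongr; linarith), h_len, h_len] at h
    simp only [abs_rpow_sq] at h
    calc _ ≤ (m : ℝ) * n * (1 / m * (1 / n) * ∫ z in Ioc ((p : ℝ) / m) (((p : ℝ) + 1) / m) ×ˢ
          Ioc ((q : ℝ) / n) (((q : ℝ) + 1) / n), |z.1 - z.2| ^ (2 * r)) :=
          mul_le_mul_of_nonneg_left h (by positivity)
      _ = _ := by field_simp

theorem setIntegral_Ioc_prod_Ioc {f : ℝ × ℝ → ℝ} {a b c d : ℝ} (hab : a ≤ b) (hcd : c ≤ d)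
    (hf : IntegrableOn f (Ioc a b ×ˢ Ioc c d)) :
    ∫ z in Ioc a b ×ˢ Ioc c d, f z = ∫ u in a..b, ∫ v in c..d, f (u, v) := by
  simp only [intervalIntegral.integral_of_le hab, intervalIntegral.integral_of_le hcd]
  exact setIntegral_prod f hf

/-- **Proposition 3.1 (computational content)**: for `H ∈ (3/4, 1)`, with `R_H` the fBm
covariance and `D_{d,d'}(p,q)` the rectangular increments of `R_H`,
`d·d' · ∑_{p<d} ∑_{q<d'} D_{d,d'}(p,q)² → H²(2H−1)² ∫_{[0,1]²} |u−v|^{4H−4} du dv`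
as `d, d' → ∞`. -/
theorem fbm_increment_covariance_sum_convergence
    (H : ℝ) (hH0 : 3 / 4 < H) (hH1 : H < 1)
    (R : ℝ → ℝ → ℝ)
    (hR : ∀ s t : ℝ, R s t = (s ^ (2 * H) + t ^ (2 * H) - |t - s| ^ (2 * H)) / 2)
    (D : ℕ → ℕ → ℕ → ℕ → ℝ)
    (hD : ∀ (d d' p q : ℕ), D d d' p q =
      R (((p : ℝ) + 1) / d) (((q : ℝ) + 1) / d') - R (((p : ℝ) + 1) / d) ((q : ℝ) / d')
        - R ((p : ℝ) / d) (((q : ℝ) + 1) / d') + R ((p : ℝ) / d) ((q : ℝ) / d')) :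
    ∀ ε > (0 : ℝ), ∃ N : ℕ, ∀ d d' : ℕ, N ≤ d → N ≤ d' →
      |(d : ℝ) * (d' : ℝ) * ∑ p ∈ Finset.range d, ∑ q ∈ Finset.range d', (D d d' p q) ^ 2
        - H ^ 2 * (2 * H - 1) ^ 2
            * ∫ u in (0 : ℝ)..1, ∫ v in (0 : ℝ)..1, |u - v| ^ (4 * H - 4)| < ε := by
  intro ε hε
  have hc : 0 < H * (2 * H - 1) := mul_pos (by linarith) (by linarith)
  have h_int := integrableOn_abs_sub_rpow (r := 2 * H - 2) (by linarith)
  have h_int2 := integrableOn_abs_sub_rpow (r := 2 * (2 * H - 2)) (by linarith)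
  have hD_eq : ∀ m n : ℕ, 0 < m → 0 < n → ∀ p ∈ Finset.range m, ∀ q ∈ Finset.range n,
      D m n p q = H * (2 * H - 1) *
        ∫ z in Ioc ((p : ℝ) / m) (((p : ℝ) + 1) / m) ×ˢ Ioc ((q : ℝ) / n) (((q : ℝ) + 1) / n),
          |z.1 - z.2| ^ (2 * H - 2) := by
    intro m n hm hn p hp q hq
    have hm' : (0 : ℝ) < m := by exact_mod_cast hm
    have hn' : (0 : ℝ) < n := by exact_mod_cast hn
    have hp' : (p : ℝ) + 1 ≤ m := by exact_mod_cast Finset.mem_range.mp hp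
    have hq' : (q : ℝ) + 1 ≤ n := by exact_mod_cast Finset.mem_range.mp hq
    rw [setIntegral_Ioc_prod_Ioc (by gcongr; linarith) (by gcongr; linarith)
      (h_int.mono_set (prod_mono
        (Ioc_subset_Ioc (by positivity) ((div_le_one hm').mpr hp'))
        (Ioc_subset_Ioc (by positivity) ((div_le_one hn').mpr hq'))))]
    have h := integral_integral_abs_sub_rpow (p := 2 * H) (by linarith) ((p : ℝ) / m)
      (((p : ℝ) + 1) / m) ((q : ℝ) / n) (((q : ℝ) + 1) / n)
    rw [hD]
    simp only [hR]
    rw [abs_sub_comm (((q : ℝ) + 1) / n) (((p : ℝ) + 1) / m),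
      abs_sub_comm ((q : ℝ) / n) (((p : ℝ) + 1) / m),
      abs_sub_comm (((q : ℝ) + 1) / n) ((p : ℝ) / m), abs_sub_comm ((q : ℝ) / n) ((p : ℝ) / m)]
    linarith
  have h_target : ∫ u in (0 : ℝ)..1, ∫ v in (0 : ℝ)..1, |u - v| ^ (4 * H - 4) =
      ∫ z in Ioc (0 : ℝ) 1 ×ˢ Ioc (0 : ℝ) 1, |z.1 - z.2| ^ (2 * (2 * H - 2)) := by
    rw [setIntegral_Ioc_prod_Ioc zero_le_one zero_le_one h_int2]
    ring_nf
  rw [h_target]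
  have h_tendsto := tendsto_setIntegral_abs_sub_add_rpow (r := 2 * (2 * H - 2)) (by linarith)
    (by linarith)
  obtain ⟨δ, hδ, h_close⟩ := Metric.mem_nhdsWithin_iff.mp
    (h_tendsto (Metric.ball_mem_nhds _ (div_pos hε (pow_pos hc 2))))
  obtain ⟨N, hN⟩ := exists_nat_gt (2 / δ)
  have hN0 : (0 : ℝ) < N := (by positivity : (0 : ℝ) < 2 / δ).trans hN
  refine ⟨N, fun m n hNm hNn => ?_⟩
  have hm' : (N : ℝ) ≤ m := by exact_mod_cast hNm
  have hn' : (N : ℝ) ≤ n := by exact_mod_cast hNn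
  have hm0 : (0 : ℝ) < m := hN0.trans_le hm'
  have hn0 : (0 : ℝ) < n := hN0.trans_le hn'
  have hm : 0 < m := by exact_mod_cast hm0
  have hn : 0 < n := by exact_mod_cast hn0
  have h_mesh : 1 / (m : ℝ) + 1 / (n : ℝ) < δ := by
    have h1 : 1 / (m : ℝ) ≤ 1 / N := one_div_le_one_div_of_le hN0 hm'
    have h2 : 1 / (n : ℝ) ≤ 1 / N := one_div_le_one_div_of_le hN0 hn'
    have h3 : 2 / (N : ℝ) < δ := by
      rw [div_lt_iff₀ hN0]
      rw [div_lt_iff₀ hδ] at hN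
      linarith
    calc _ ≤ 1 / (N : ℝ) + 1 / N := add_le_add h1 h2
      _ = 2 / N := by ring
      _ < δ := h3
  have h_mesh_pos : 0 < 1 / (m : ℝ) + 1 / (n : ℝ) := by positivity
  have h_near := h_close ⟨by
    rw [Metric.mem_ball, Real.dist_eq, sub_zero, abs_of_pos h_mesh_pos]; exact h_mesh, h_mesh_pos⟩
  rw [mem_preimage, Metric.mem_ball, Real.dist_eq, abs_lt] at h_near
  obtain ⟨h_lower, h_upper⟩ :=
    sum_cell_bounds (r := 2 * H - 2) (by linarith) (by linarith) hm hn
  have h_sum : ∑ p ∈ Finset.range m, ∑ q ∈ Finset.range n, D m n p q ^ 2 =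
      (H * (2 * H - 1)) ^ 2 * ∑ p ∈ Finset.range m, ∑ q ∈ Finset.range n,
        (∫ z in Ioc ((p : ℝ) / m) (((p : ℝ) + 1) / m) ×ˢ Ioc ((q : ℝ) / n) (((q : ℝ) + 1) / n),
          |z.1 - z.2| ^ (2 * H - 2)) ^ 2 := by
    simp only [Finset.mul_sum]
    exact Finset.sum_congr rfl fun p hp => Finset.sum_congr rfl fun q hq => by
      rw [hD_eq m n hm hn p hp q hq, mul_pow]
  rw [h_sum, ← mul_pow, mul_left_comm, ← mul_sub, abs_mul, abs_of_pos (pow_pos hc 2),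
    mul_comm, ← lt_div_iff₀ (pow_pos hc 2), abs_lt]
  constructor <;> linarith [h_near.1]
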